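/- arXiv:2208.06654 — 3 statements merged into one kernel-verified Lean document; each statement's English description precedes it below -/
import Mathlib

section
/- Fix ρ₁ > 0, a pressure law p continuously differentiable on (0,∞) with p' > 0 there, the enthalpy h(z) = ∫_{ρ₁}^{z} p'(s)/s ds, and constants g > 0, b > 0. Assume there exists z₀ > ρ₁ with g·b ≤ h(z₀). Then there exists a function ρ̄ : [-b, 0] → ℝ such that: ρ̄(0) = ρ₁; ρ₁ ≤ ρ̄(x) ≤ z₀ for all x ∈ [-b, 0]; ρ̄ is strictly decreasing on [-b, 0]; h(ρ̄(x)) = -g·x for all x ∈ [-b, 0]; and for every x in the open interval (-b, 0) the function y ↦ p(ρ̄(y)) is differentiable at x with derivative equal to -g·ρ̄(x) (the hydrostatic balance equation dp(ρ̄)/dx = -g ρ̄). -/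
open Set Filter Topology in
/-- If `h` is strictly increasing on an open set containing the range of a right inverse `r` over
`s`, and `h` is differentiable with nonzero derivative at `r t` for `t` in the interior of `s`,
then `r` is differentiable at `t`. -/
theorem StrictMonoOn.hasDerivAt_rightInverse {h r : ℝ → ℝ} {U s : Set ℝ} {t m : ℝ}
    (hmono : StrictMonoOn h U) (hU : IsOpen U) (hs : s ∈ 𝓝 t) (hrU : MapsTo r s U)
    (hr : ∀ y ∈ s, h (r y) = y) (hd : HasDerivAt h m (r t)) (hm : m ≠ 0) :
    HasDerivAt r m⁻¹ t := by
  have hts : t ∈ s := mem_of_mem_nhds hs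
  have hrmono : StrictMonoOn r s := fun x hx y hy hxy => by
    rwa [← hmono.lt_iff_lt (hrU hx) (hrU hy), hr x hx, hr y hy]
  have himage : r '' s ∈ 𝓝 (r t) := by
    have hpre : h ⁻¹' s ∈ 𝓝 (r t) := hd.continuousAt.preimage_mem_nhds (by rwa [hr t hts])
    filter_upwards [hpre, hU.mem_nhds (hrU hts)] with y hys hyU
    exact ⟨h y, hys, hmono.injOn (hrU hys) hyU (hr _ hys)⟩
  exact HasDerivAt.of_local_left_inverse (hrmono.continuousAt_of_image_mem_nhds hs himage)
    hd hm (by filter_upwards [hs] with y hy using hr y hy)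

open Set in
theorem hasDerivAt_integral_of_continuousOn_Ioi {f : ℝ → ℝ} {c a z : ℝ}
    (hf : ContinuousOn f (Ioi c)) (ha : c < a) (hz : c < z) :
    HasDerivAt (fun u => ∫ s in a..u, f s) (f z) z := by
  refine intervalIntegral.integral_hasDerivAt_right ?_
    (hf.stronglyMeasurableAtFilter isOpen_Ioi z hz) (hf.continuousAt (Ioi_mem_nhds hz))
  exact (hf.mono fun x hx => (lt_min ha hz).trans_le hx.1).intervalIntegrable

/-- Existence of the hydrostatic equilibrium density: if `g·b ≤ h z₀` for some `z₀ > ρ₁`,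
there is a strictly decreasing `ρ̄` on `[-b, 0]` with `ρ̄ 0 = ρ₁`, `ρ₁ ≤ ρ̄ ≤ z₀`,
`h (ρ̄ x) = -g x`, and `d/dx p(ρ̄(x)) = -g ρ̄(x)` in `(-b, 0)`. -/
theorem hydrostatic_existence
    (ρ₁ g b z₀ : ℝ) (hρ₁ : 0 < ρ₁) (hg : 0 < g) (hb : 0 < b)
    (p p' : ℝ → ℝ)
    (hderiv : ∀ s, 0 < s → HasDerivAt p (p' s) s)
    (hcont : ContinuousOn p' (Set.Ioi 0))
    (hpos : ∀ s, 0 < s → 0 < p' s)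
    (h : ℝ → ℝ)
    (hdef : ∀ z, h z = ∫ s in ρ₁..z, p' s / s)
    (hz₀ : ρ₁ < z₀) (hgb : g * b ≤ h z₀) :
    ∃ ρb : ℝ → ℝ,
      ρb 0 = ρ₁ ∧
      (∀ x ∈ Set.Icc (-b) 0, ρ₁ ≤ ρb x ∧ ρb x ≤ z₀) ∧
      StrictAntiOn ρb (Set.Icc (-b) 0) ∧
      (∀ x ∈ Set.Icc (-b) 0, h (ρb x) = -(g * x)) ∧
      (∀ x ∈ Set.Ioo (-b) 0, HasDerivAt (fun y => p (ρb y)) (-(g * ρb x)) x) := by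
  have hint : ContinuousOn (fun s => p' s / s) (Set.Ioi 0) :=
    hcont.div continuousOn_id fun x hx => ne_of_gt hx
  have hh : ∀ z, 0 < z → HasDerivAt h (p' z / z) z := fun z hz => by
    rw [funext hdef]
    exact hasDerivAt_integral_of_continuousOn_Ioi hint hρ₁ hz
  have hhcont : ContinuousOn h (Set.Ioi 0) := fun z hz => (hh z hz).continuousAt.continuousWithinAt
  have hmono : StrictMonoOn h (Set.Ioi 0) := by
    refine strictMonoOn_of_deriv_pos (convex_Ioi 0) hhcont fun z hz => ?_
    rw [interior_Ioi] at hz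
    rw [(hh z hz).deriv]
    exact div_pos (hpos z hz) hz
  have hh₁ : h ρ₁ = 0 := by rw [hdef, intervalIntegral.integral_same]
  have hsurj : ∀ t ∈ Set.Icc 0 (g * b), ∃ z ∈ Set.Icc ρ₁ z₀, h z = t := fun t ht =>
    intermediate_value_Icc hz₀.le (hhcont.mono fun z hz => hρ₁.trans_le hz.1)
      ⟨hh₁.le.trans ht.1, ht.2.trans hgb⟩
  choose! r hr hhr using hsurj
  have hrpos : Set.MapsTo r (Set.Icc 0 (g * b)) (Set.Ioi 0) := fun t ht =>
    hρ₁.trans_le (hr t ht).1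
  have hmem : ∀ x ∈ Set.Icc (-b) 0, -(g * x) ∈ Set.Icc 0 (g * b) := fun x hx =>
    ⟨by nlinarith [hx.2], by nlinarith [hx.1]⟩
  have hzero : (0 : ℝ) ∈ Set.Icc 0 (g * b) := ⟨le_rfl, by positivity⟩
  refine ⟨fun x => r (-(g * x)), ?_, fun x hx => hr _ (hmem x hx), fun x hx y hy hxy => ?_,
    fun x hx => hhr _ (hmem x hx), fun x hx => ?_⟩
  · simp only [mul_zero, neg_zero]
    exact hmono.injOn (hrpos hzero) hρ₁ ((hhr 0 hzero).trans hh₁.symm)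
  · rw [← hmono.lt_iff_lt (hrpos (hmem y hy)) (hrpos (hmem x hx)), hhr _ (hmem y hy),
      hhr _ (hmem x hx)]
    nlinarith
  · have ht : -(g * x) ∈ Set.Icc 0 (g * b) := hmem x (Set.Ioo_subset_Icc_self hx)
    have hnhds : Set.Icc 0 (g * b) ∈ nhds (-(g * x)) :=
      Icc_mem_nhds (by nlinarith [hx.2]) (by nlinarith [hx.1])
    have hrt : 0 < r (-(g * x)) := hrpos ht
    have hp' := hpos _ hrt
    have hdr := hmono.hasDerivAt_rightInverse isOpen_Ioi hnhds hrpos hhr (hh _ hrt)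
      (div_pos hp' hrt).ne'
    have hlin : HasDerivAt (fun y => -(g * y)) (-(g * 1)) x := ((hasDerivAt_id x).const_mul g).neg
    refine ((hderiv _ hrt).comp x (hdr.comp x hlin)).congr_deriv ?_
    field_simp
end

section
/- (Piola identity.) Let η : ℝ³ → ℝ³ be twice continuously differentiable, and for x ∈ ℝ³ let Dη(x) be the 3×3 Jacobian matrix with entries (Dη(x))_{i j} = ∂_j η^i(x). Then every row of the cofactor matrix of Dη is divergence-free: for each i ∈ {1,2,3} and every x ∈ ℝ³, ∑_{j=1}^{3} ∂_j [ adjugate(Dη(x)) ]_{j i} = 0, where the partial derivative ∂_j is applied to the function x ↦ adjugate(Dη(x))_{j i}. Equivalently, writing J = det(Dη) and 𝒜 = (Dη)^{-T} wherever Dη(x) is invertible, ∂_j(J 𝒜_i^j) = 0. -/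
/-- The Jacobian matrix of a map `η : ℝ³ → ℝ³`: `(Dmat η x) i j = ∂_j η^i (x)`. -/
noncomputable def Dmat (η : (Fin 3 → ℝ) → (Fin 3 → ℝ)) (x : Fin 3 → ℝ) :
    Matrix (Fin 3) (Fin 3) ℝ :=
  fun i j => fderiv ℝ η x (Pi.single j 1) i

theorem contDiff_Dmat_apply {η : (Fin 3 → ℝ) → (Fin 3 → ℝ)} (hη : ContDiff ℝ 2 η)
    (i j : Fin 3) : ContDiff ℝ 1 (fun y => Dmat η y i j) := by
  have h : ContDiff ℝ 1 (fun y => fderiv ℝ η y (Pi.single j 1)) :=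
    (hη.fderiv_right (by norm_num)).clm_apply contDiff_const
  exact contDiff_pi.1 h i

theorem fderiv_Dmat_apply {η : (Fin 3 → ℝ) → (Fin 3 → ℝ)} (hη : ContDiff ℝ 2 η)
    (i j : Fin 3) (x v : Fin 3 → ℝ) :
    fderiv ℝ (fun y => Dmat η y i j) x v = fderiv ℝ (fderiv ℝ η) x v (Pi.single j 1) i := by
  have h : DifferentiableAt ℝ (fderiv ℝ η) x :=
    (hη.fderiv_right (m := 1) (by norm_num)).differentiable (by norm_num) x
  have h' := hasFDerivAt_pi'.1 (h.hasFDerivAt.clm_apply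
    (hasFDerivAt_const (Pi.single j (1 : ℝ) : Fin 3 → ℝ) x)) i
  have h'' : HasFDerivAt (fun y => Dmat η y i j) _ x := h'
  rw [h''.fderiv]
  simp

/-- Equality of mixed second partial derivatives, in terms of the Jacobian matrix. -/
theorem fderiv_Dmat_single_comm {η : (Fin 3 → ℝ) → (Fin 3 → ℝ)} (hη : ContDiff ℝ 2 η)
    (i j k : Fin 3) (x : Fin 3 → ℝ) :
    fderiv ℝ (fun y => Dmat η y i j) x (Pi.single k 1) =
      fderiv ℝ (fun y => Dmat η y i k) x (Pi.single j 1) := by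
  rw [fderiv_Dmat_apply hη, fderiv_Dmat_apply hη]
  have h : IsSymmSndFDerivAt ℝ η x := hη.contDiffAt.isSymmSndFDerivAt (by simp)
  rw [h.eq]

/-- Piola identity: for a `C²` map `η : ℝ³ → ℝ³`, every row of the cofactor matrix of
`Dη` is divergence-free: `∑_j ∂_j (adjugate (Dη x))_{j i} = 0` for each `i` and every `x`
(equivalently `∂_j (J 𝒜_i^j) = 0` where `J = det Dη`, `𝒜 = (Dη)^{-T}`). -/
theorem piola_identity
    (η : (Fin 3 → ℝ) → (Fin 3 → ℝ)) (hη : ContDiff ℝ 2 η) :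
    ∀ (i : Fin 3) (x : Fin 3 → ℝ),
      ∑ j : Fin 3,
        fderiv ℝ (fun y => Matrix.adjugate (Dmat η y) j i) x (Pi.single j 1) = 0 := by
  intro i x
  have hd (a b : Fin 3) : DifferentiableAt ℝ (fun y => Dmat η y a b) x :=
    (contDiff_Dmat_apply hη a b).differentiable (by norm_num) x
  have hminor (a b c d e f g h : Fin 3) (v : Fin 3 → ℝ) :
      fderiv ℝ (fun y => Dmat η y a b * Dmat η y c d - Dmat η y e f * Dmat η y g h) x v =
        Dmat η x a b * fderiv ℝ (fun y => Dmat η y c d) x v +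
          Dmat η x c d * fderiv ℝ (fun y => Dmat η y a b) x v -
        (Dmat η x e f * fderiv ℝ (fun y => Dmat η y g h) x v +
          Dmat η x g h * fderiv ℝ (fun y => Dmat η y e f) x v) := by
    rw [fderiv_fun_sub ((hd a b).fun_mul (hd c d)) ((hd e f).fun_mul (hd g h)),
      fderiv_fun_mul (hd a b) (hd c d), fderiv_fun_mul (hd e f) (hd g h)]
    simp
  have h10 (a : Fin 3) := fderiv_Dmat_single_comm hη a 1 0 x
  have h20 (a : Fin 3) := fderiv_Dmat_single_comm hη a 2 0 x
  have h21 (a : Fin 3) := fderiv_Dmat_single_comm hη a 2 1 x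
  fin_cases i <;>
  · simp only [Fin.sum_univ_three, Matrix.adjugate_fin_three, Matrix.of_apply, Matrix.cons_val,
      Fin.zero_eta, Fin.mk_one, Fin.reduceFinMk, neg_add_eq_sub, hminor, h10, h20, h21]
    ring
end

section
/- Let ℓ₀ > 1/2, c > 0 and K > 0. Suppose f, D : [0,∞) → ℝ are nonnegative, f is differentiable, D is continuous, and suppose f'(t) + c·D(t) ≤ 0 for all t ≥ 0 and f(t) ≤ K·(1+t)^{−2ℓ₀} for all t ≥ 0. Then there exist constants C₁, C₂ > 0 depending only on ℓ₀ and c such that for every T ≥ 0: (i) ∫₀ᵀ (1+τ)^{ℓ₀ + 1/2} D(τ) dτ ≤ C₁·K, and (ii) ∫₀ᵀ D(τ)^{1/2} dτ ≤ C₂·K^{1/2}. (This is the weighted dissipation bound ∫₀ᵗ ⟨τ⟩^{ℓ₀+1/2} 𝓓̇ₛ dτ ≲ 𝓔_{s+ℓ₀}(0) and ∫₀ᵗ 𝓓̇ₛ^{1/2} dτ ≲ 𝓔_{s+ℓ₀}(0)^{1/2} used in the proof of the global well-posedness theorem.) -/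
/-- The derivative of a shifted real power. -/
lemma hasDerivAt_one_add_rpow (p : ℝ) {t : ℝ} (ht : 0 ≤ t) :
    HasDerivAt (fun x : ℝ => (1 + x) ^ p) (p * (1 + t) ^ (p - 1)) t := by
  have h := ((hasDerivAt_id t).const_add 1).rpow_const (p := p)
    (Or.inl (by simp only [id]; positivity))
  simpa using h

lemma continuousOn_one_add_rpow (p : ℝ) :
    ContinuousOn (fun x : ℝ => (1 + x) ^ p) (Set.Ici 0) :=
  fun _ hx => (hasDerivAt_one_add_rpow p hx).continuousAt.continuousWithinAt

/-- The integral of `(1 + τ) ^ (-a)` over `[0, T]` is at most `1 / (a - 1)` when `1 < a`. -/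
lemma integral_one_add_rpow_neg_le {a T : ℝ} (ha : 1 < a) (hT : 0 ≤ T) :
    ∫ τ in (0 : ℝ)..T, (1 + τ) ^ (-a) ≤ 1 / (a - 1) := by
  have ha' : 0 < a - 1 := by linarith
  have h := intervalIntegral.integral_le_sub_of_hasDeriv_right_of_le hT
    (g := fun t => -(1 / (a - 1)) * (1 + t) ^ (1 - a)) (g' := fun t => (1 + t) ^ (-a))
    (φ := fun t => (1 + t) ^ (-a))
    (((continuousOn_one_add_rpow (1 - a)).mono Set.Icc_subset_Ici_self).const_mul _)
    (fun t ht => by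
      have h1 := ((hasDerivAt_one_add_rpow (1 - a) ht.1.le).const_mul
        (-(1 / (a - 1)))).hasDerivWithinAt (s := Set.Ioi t)
      refine h1.congr_deriv ?_
      rw [show 1 - a - 1 = -a by ring]
      field_simp
      ring)
    (((continuousOn_one_add_rpow (-a)).mono Set.Icc_subset_Ici_self).integrableOn_Icc)
    (fun _ _ => le_rfl)
  have hpos : 0 ≤ 1 / (a - 1) * (1 + T) ^ (1 - a) := by positivity
  simp only [add_zero, Real.one_rpow] at h
  linarith

/-- A decaying energy controls the weighted integral of its dissipation. -/
lemma integral_weight_mul_dissipation_le {a c K T : ℝ} (ha : 1 < a) (hc : 0 < c) (hK : 0 < K)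
    (hT : 0 ≤ T) {f f' D : ℝ → ℝ} (hf : ∀ t, 0 ≤ t → 0 ≤ f t)
    (hder : ∀ t, 0 ≤ t → HasDerivWithinAt f (f' t) (Set.Ici 0) t)
    (hD : ContinuousOn D (Set.Ici 0))
    (hdiss : ∀ t, 0 ≤ t → f' t + c * D t ≤ 0)
    (hdecay : ∀ t, 0 ≤ t → f t ≤ K * (1 + t) ^ (1 - 2 * a)) :
    ∫ τ in (0 : ℝ)..T, (1 + τ) ^ a * D τ ≤ (1 + a / (a - 1)) / c * K := by
  have ha' : 0 < a - 1 := by linarith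
  have hfc : ContinuousOn f (Set.Ici 0) := fun t ht => (hder t ht).continuousWithinAt
  have hsub : Set.Icc 0 T ⊆ Set.Ici 0 := Set.Icc_subset_Ici_self
  have h := intervalIntegral.integral_le_sub_of_hasDeriv_right_of_le hT
    (g := fun t => -((1 + t) ^ a * f t) - a * K / (a - 1) * (1 + t) ^ (1 - a))
    (g' := fun t => -(a * (1 + t) ^ (a - 1) * f t + (1 + t) ^ a * f' t)
      + a * K * (1 + t) ^ (-a))
    (φ := fun t => c * ((1 + t) ^ a * D t))
    ((((continuousOn_one_add_rpow a).mul hfc).neg.sub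
      ((continuousOn_one_add_rpow (1 - a)).const_mul _)).mono hsub)
    (fun t ht => by
      have h1 := (hasDerivAt_one_add_rpow a ht.1.le).hasDerivWithinAt (s := Set.Ioi t)
      have h2 := (hder t ht.1.le).mono
        (show Set.Ioi t ⊆ Set.Ici 0 from fun x hx => (ht.1.trans hx).le)
      have h3 := ((hasDerivAt_one_add_rpow (1 - a) ht.1.le).const_mul
        (a * K / (a - 1))).hasDerivWithinAt (s := Set.Ioi t)
      refine ((h1.mul h2).neg.sub h3).congr_deriv ?_
      rw [show 1 - a - 1 = -a by ring]
      field_simp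
      ring)
    (((((continuousOn_one_add_rpow a).mul hD).const_mul c).mono hsub).integrableOn_Icc)
    (fun t ht => by
      have ht0 : 0 < 1 + t := by linarith [ht.1]
      have hw : 0 ≤ (1 + t) ^ a := by positivity
      have h1 := mul_le_mul_of_nonneg_left (hdiss t ht.1.le) hw
      have h2 := mul_le_mul_of_nonneg_left (hdecay t ht.1.le)
        (show 0 ≤ a * (1 + t) ^ (a - 1) by positivity)
      have h3 : a * (1 + t) ^ (a - 1) * (K * (1 + t) ^ (1 - 2 * a))
          = a * K * (1 + t) ^ (-a) := by
        rw [show -a = (a - 1) + (1 - 2 * a) by ring, Real.rpow_add ht0]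
        ring
      linarith)
  have hend : 0 ≤ (1 + T) ^ a * f T := mul_nonneg (by positivity) (hf T hT)
  have hend' : 0 ≤ a * K / (a - 1) * (1 + T) ^ (1 - a) := by positivity
  have hstart := hdecay 0 le_rfl
  rw [intervalIntegral.integral_const_mul] at h
  simp only [add_zero, Real.one_rpow, one_mul, mul_one] at h hstart
  rw [div_mul_eq_mul_div, le_div_iff₀ hc]
  have : (1 + a / (a - 1)) * K = K + a * K / (a - 1) := by ring
  linarith

/-- Young's inequality for a square root, with a weight `w` and a scale `k`. -/
lemma sqrt_le_weighted_add {w k d : ℝ} (hw : 0 < w) (hk : 0 < k) (hd : 0 ≤ d) :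
    √d ≤ 1 / (2 * k) * (w * d) + k / 2 * w⁻¹ := by
  have h := sq_nonneg (w * √d - k)
  have hs := Real.sq_sqrt hd
  have heq : 1 / (2 * k) * (w * d) + k / 2 * w⁻¹ - √d
      = (w * √d - k) ^ 2 / (2 * k * w) := by
    rw [sub_sq, mul_pow, hs]
    field_simp
    ring
  have : 0 ≤ (w * √d - k) ^ 2 / (2 * k * w) := by positivity
  linarith

/-- Weighted dissipation bound: if `f' + c D ≤ 0` on `[0,∞)` with `f, D ≥ 0`, `D`
continuous, and `f t ≤ K (1+t)^{-2ℓ₀}` with `ℓ₀ > 1/2`, then (with constants depending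
only on `ℓ₀` and `c`) `∫₀ᵀ (1+τ)^{ℓ₀+1/2} D dτ ≤ C₁ K` and `∫₀ᵀ D^{1/2} dτ ≤ C₂ K^{1/2}`
for every `T ≥ 0`. -/
theorem weighted_dissipation_bound
    (ℓ₀ c : ℝ) (hℓ : 1 / 2 < ℓ₀) (hc : 0 < c) :
    ∃ C₁ > 0, ∃ C₂ > 0,
      ∀ (K : ℝ), 0 < K →
      ∀ (f f' D : ℝ → ℝ),
        (∀ t, 0 ≤ t → 0 ≤ f t) →
        (∀ t, 0 ≤ t → 0 ≤ D t) →
        (∀ t, 0 ≤ t → HasDerivWithinAt f (f' t) (Set.Ici 0) t) →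
        ContinuousOn D (Set.Ici 0) →
        (∀ t, 0 ≤ t → f' t + c * D t ≤ 0) →
        (∀ t, 0 ≤ t → f t ≤ K * (1 + t) ^ (-(2 * ℓ₀))) →
        ∀ T, 0 ≤ T →
          (∫ τ in (0:ℝ)..T, (1 + τ) ^ (ℓ₀ + 1 / 2) * D τ) ≤ C₁ * K ∧
          (∫ τ in (0:ℝ)..T, Real.sqrt (D τ)) ≤ C₂ * Real.sqrt K := by
  have ha : 1 < ℓ₀ + 1 / 2 := by linarith
  have ha' : 0 < ℓ₀ + 1 / 2 - 1 := by linarith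
  set a := ℓ₀ + 1 / 2 with ha_def
  set C := (1 + a / (a - 1)) / c with hC
  have hCpos : 0 < C := by positivity
  refine ⟨C, hCpos, (C + 1 / (a - 1)) / 2, by positivity, ?_⟩
  intro K hK f f' D hf hDnonneg hder hD hdiss hdecay T hT
  have hweighted : ∫ τ in (0 : ℝ)..T, (1 + τ) ^ a * D τ ≤ C * K :=
    integral_weight_mul_dissipation_le ha hc hK hT hf hder hD hdiss fun t ht => by
      rw [show 1 - 2 * a = -(2 * ℓ₀) by rw [ha_def]; ring]
      exact hdecay t ht
  refine ⟨hweighted, ?_⟩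
  have hk : 0 < √K := Real.sqrt_pos.2 hK
  have hsub : Set.uIcc 0 T ⊆ Set.Ici 0 := by
    rw [Set.uIcc_of_le hT]
    exact Set.Icc_subset_Ici_self
  have hint₁ : IntervalIntegrable (fun τ => 1 / (2 * √K) * ((1 + τ) ^ a * D τ))
      MeasureTheory.volume 0 T :=
    ((((continuousOn_one_add_rpow a).mul hD).const_mul _).mono hsub).intervalIntegrable
  have hint₂ : IntervalIntegrable (fun τ : ℝ => √K / 2 * (1 + τ) ^ (-a))
      MeasureTheory.volume 0 T :=
    (((continuousOn_one_add_rpow (-a)).const_mul _).mono hsub).intervalIntegrable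
  calc ∫ τ in (0 : ℝ)..T, √(D τ)
      ≤ ∫ τ in (0 : ℝ)..T,
          (1 / (2 * √K) * ((1 + τ) ^ a * D τ) + √K / 2 * (1 + τ) ^ (-a)) := by
        refine intervalIntegral.integral_mono_on hT
          ((hD.sqrt.mono hsub).intervalIntegrable) (hint₁.add hint₂) fun t ht => ?_
        have ht0 : 0 < 1 + t := by linarith [ht.1]
        rw [Real.rpow_neg ht0.le]
        exact sqrt_le_weighted_add (by positivity) hk (hDnonneg t ht.1)
    _ = 1 / (2 * √K) * (∫ τ in (0 : ℝ)..T, (1 + τ) ^ a * D τ)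
          + √K / 2 * ∫ τ in (0 : ℝ)..T, (1 + τ) ^ (-a) := by
        rw [intervalIntegral.integral_add hint₁ hint₂, intervalIntegral.integral_const_mul,
          intervalIntegral.integral_const_mul]
    _ ≤ 1 / (2 * √K) * (C * K) + √K / 2 * (1 / (a - 1)) := by
        gcongr
        exact integral_one_add_rpow_neg_le ha hT
    _ = (C + 1 / (a - 1)) / 2 * √K := by
        have hKsq : K = √K * √K := (Real.mul_self_sqrt hK.le).symm
        have : 1 / (2 * √K) * (C * K) = C / 2 * √K := by
          rw [div_mul_eq_mul_div, div_eq_iff (by positivity)]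
          linear_combination C * hKsq
        rw [this]
        ring
end
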